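/- arXiv:1602.05338 — 10 statements merged into one kernel-verified Lean document; each statement's English description precedes it below -/
import Mathlib

section
/- Let A be a filtered ring with F₀A = B and let S be a left Ore set in A such that σ(S) is a left Ore set in G(A), G(A) is σ(S)-torsion free, and S ⊄ B. Then S ∖ B is multiplicatively closed and is a left Ore set in A. -/
/-- An exhaustive and separated ascending `ℤ`-filtration `F` on a ring `A`:
`1 ∈ F 0`, `F m * F n ⊆ F (m+n)`, `⋃ F n = A` and `⋂ F n = 0`. -/
structure RingFiltration (A : Type*) [Ring A] where
  F : ℤ → AddSubgroup A
  mono : Monotone F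
  one_mem : (1 : A) ∈ F 0
  mul_mem : ∀ {m n : ℤ} {x y : A}, x ∈ F m → y ∈ F n → x * y ∈ F (m + n)
  exhaustive : ∀ a : A, ∃ n : ℤ, a ∈ F n
  separated : ∀ a : A, (∀ n : ℤ, a ∈ F n) → a = 0
/-- Homogeneous formulation of: the associated graded ring `G(A)` is `σ(S)`-torsion
free.  For `a ∈ F n`, the hypothesis `∀ p, s ∈ F p → s * a ∈ F (p + n - 1)` says
exactly that `σ(s) · (a mod F (n-1)) = 0` in `G(A)`; torsion-freeness says that this
forces the class of `a` in `G(A)_n = F n / F (n-1)` to vanish. -/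
def RingFiltration.SigmaTorsionFree {A : Type*} [Ring A] (FA : RingFiltration A)
    (S : Set A) : Prop :=
  ∀ s ∈ S, ∀ n : ℤ, ∀ a ∈ FA.F n,
    (∀ p : ℤ, s ∈ FA.F p → s * a ∈ FA.F (p + n - 1)) → a ∈ FA.F (n - 1)
def MulClosed {A : Type*} [Mul A] (S : Set A) : Prop :=
  ∀ s ∈ S, ∀ t ∈ S, s * t ∈ S

/-- The left Ore condition for a subset `S` of a ring `A`. -/
def LeftOreCond {A : Type*} [Ring A] (S : Set A) : Prop :=
  ∀ a : A, ∀ s ∈ S, ∃ s' ∈ S, ∃ a' : A, s' * a = a' * s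

/-- The second (cancellation) left Ore condition. -/
def LeftOreCancel {A : Type*} [Ring A] (S : Set A) : Prop :=
  ∀ a : A, ∀ s ∈ S, a * s = 0 → ∃ s' ∈ S, s' * a = 0

/-- A left Ore set: a multiplicatively closed set containing `1` which satisfies
both left Ore conditions. -/
def IsLeftOreSet {A : Type*} [Ring A] (S : Set A) : Prop :=
  1 ∈ S ∧ MulClosed S ∧ LeftOreCond S ∧ LeftOreCancel S
/-- Homogeneous formulation of: `σ(S)` is a left Ore set in the associated graded
ring `G(A)`: the left Ore condition and the cancellation condition for the symbols
`σ(s)`, `s ∈ S`, on homogeneous elements of `G(A)`. -/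
def RingFiltration.SigmaLeftOre {A : Type*} [Ring A] (FA : RingFiltration A)
    (S : Set A) : Prop :=
  (∀ s ∈ S, ∀ p : ℤ, s ∈ FA.F p → ∀ (a : A) (n : ℤ), a ∈ FA.F n →
      ∃ s' ∈ S, ∃ p' : ℤ, s' ∈ FA.F p' ∧ ∃ a' : A, ∃ n' : ℤ, a' ∈ FA.F n' ∧
        p' + n = n' + p ∧ s' * a - a' * s ∈ FA.F (p' + n - 1)) ∧
  (∀ s ∈ S, ∀ p : ℤ, s ∈ FA.F p → ∀ (a : A) (n : ℤ), a ∈ FA.F n →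
      a * s ∈ FA.F (n + p - 1) →
      ∃ s' ∈ S, ∃ p' : ℤ, s' ∈ FA.F p' ∧ s' * a ∈ FA.F (p' + n - 1))

namespace RingFiltration

variable {A : Type*} [Ring A] {FA : RingFiltration A} {S : Set A}

theorem exists_degree (FA : RingFiltration A) {x : A} {j : ℤ} (hx : x ∉ FA.F j) :
    ∃ n : ℤ, j < n ∧ x ∈ FA.F n ∧ x ∉ FA.F (n - 1) := by
  have hlt : ∀ n : ℤ, x ∈ FA.F n → j < n := fun n hn =>
    not_le.mp fun h => hx (FA.mono h hn)
  obtain ⟨n, hn, hmin⟩ := Int.exists_least_of_bdd (P := fun n => x ∈ FA.F n)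
    ⟨j, fun n hn => (hlt n hn).le⟩ (FA.exhaustive x)
  refine ⟨n, hlt n hn, hn, fun h => ?_⟩
  have := hmin _ h
  omega

theorem exists_notMem (FA : RingFiltration A) {x : A} (hx : x ≠ 0) :
    ∃ j : ℤ, x ∉ FA.F j := by
  by_contra! h
  exact hx (FA.separated x h)

/-- Multiplying on the left by an element of `S` adds degrees. -/
theorem SigmaTorsionFree.exists_mul_notMem (htf : FA.SigmaTorsionFree S) {s x : A}
    (hs : s ∈ S) {n : ℤ} (hx : x ∈ FA.F n) (hx' : x ∉ FA.F (n - 1)) :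
    ∃ p : ℤ, s ∈ FA.F p ∧ s * x ∉ FA.F (p + n - 1) := by
  by_contra! h
  exact hx' (htf s hs n x hx h)

theorem SigmaTorsionFree.mul_ne_zero (htf : FA.SigmaTorsionFree S) {s x : A}
    (hs : s ∈ S) (hx : x ≠ 0) : s * x ≠ 0 := by
  obtain ⟨j, hj⟩ := FA.exists_notMem hx
  obtain ⟨n, -, hn, hn'⟩ := FA.exists_degree hj
  obtain ⟨p, -, hp⟩ := htf.exists_mul_notMem hs hn hn'
  intro h
  exact hp (h ▸ zero_mem _)

theorem SigmaTorsionFree.mul_notMem_add_one (htf : FA.SigmaTorsionFree S) {s x : A}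
    (hs : s ∈ S) (hs₀ : s ∉ FA.F 0) {j : ℤ} (hx : x ∉ FA.F j) :
    s * x ∉ FA.F (j + 1) := by
  obtain ⟨n, hjn, hn, hn'⟩ := FA.exists_degree hx
  obtain ⟨p, hp, hpn⟩ := htf.exists_mul_notMem hs hn hn'
  have hp₀ : 0 < p := not_le.mp fun h => hs₀ (FA.mono h hp)
  exact fun h => hpn (FA.mono (by omega) h)

theorem SigmaTorsionFree.pow_mul_notMem (htf : FA.SigmaTorsionFree S) {s x : A}
    (hs : s ∈ S) (hs₀ : s ∉ FA.F 0) {j : ℤ} (hx : x ∉ FA.F j) (k : ℕ) :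
    s ^ k * x ∉ FA.F (j + k) := by
  induction k with
  | zero => simpa using hx
  | succ k ih =>
    have := htf.mul_notMem_add_one hs hs₀ ih
    rwa [← mul_assoc, ← pow_succ', add_assoc, ← Nat.cast_succ] at this

end RingFiltration

theorem MulClosed.pow_mul_mem {A : Type*} [Monoid A] {S : Set A} (hS : MulClosed S)
    {s x : A} (hs : s ∈ S) (hx : x ∈ S) (k : ℕ) : s ^ k * x ∈ S := by
  induction k with
  | zero => simpa using hx
  | succ k ih =>
    rw [pow_succ', mul_assoc]
    exact hS _ hs _ ih

/-- If `S` is a left Ore set of the filtered ring `A` with `S ⊄ B`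
(`B = F 0 A`), `σ(S)` is a left Ore set in `G(A)` and `G(A)` is `σ(S)`-torsion
free, then `S \ B` is multiplicatively closed and a left Ore set in `A`. -/
theorem stmt2 {A : Type*} [Ring A] (FA : RingFiltration A) (S : Set A)
    (hS : IsLeftOreSet S)
    (hOre : FA.SigmaLeftOre S) (htf : FA.SigmaTorsionFree S)
    (hSB : ¬ S ⊆ (FA.F 0 : Set A)) :
    MulClosed (S \ (FA.F 0 : Set A)) ∧
    LeftOreCond (S \ (FA.F 0 : Set A)) ∧
    LeftOreCancel (S \ (FA.F 0 : Set A)) := by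
  obtain ⟨-, hmul, hore, hcan⟩ := hS
  obtain ⟨t, htS, ht⟩ := Set.not_subset.mp hSB
  refine ⟨?_, ?_, ?_⟩
  · rintro s ⟨hs, hs₀⟩ u ⟨hu, hu₀⟩
    exact ⟨hmul s hs u hu, fun h =>
      htf.mul_notMem_add_one hs hs₀ hu₀ (FA.mono (by omega) h)⟩
  · rintro a s ⟨hs, -⟩
    obtain ⟨s', hs', a', h⟩ := hore a s hs
    have ht₀ : t ≠ 0 := fun h => ht (h ▸ zero_mem (FA.F 0))
    have hs'₀ : s' ≠ 0 := fun h => htf.mul_ne_zero hs' ht₀ (by rw [h, zero_mul])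
    obtain ⟨j, hj⟩ := FA.exists_notMem hs'₀
    refine ⟨t ^ j.natAbs * s', ⟨hmul.pow_mul_mem htS hs' _, fun h₀ => ?_⟩,
      t ^ j.natAbs * a', by rw [mul_assoc, h, mul_assoc]⟩
    exact htf.pow_mul_notMem htS ht hj j.natAbs (FA.mono (by omega) h₀)
  · rintro a s ⟨hs, -⟩ h
    obtain ⟨s', hs', h'⟩ := hcan a s hs h
    have ha : a = 0 := by
      by_contra ha
      exact htf.mul_ne_zero hs' ha h'
    exact ⟨t, ⟨htS, ht⟩, by rw [ha, mul_zero]⟩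
end

section
/- Let A be a filtered ring with F₀A = B, and let S be a left Ore set in A such that S ∩ B is also a left Ore set in A, σ(S) is a left Ore set in G(A), G(A) is σ(S)-torsion free, and S ⊄ B. Then S ∖ B is a left Ore set in the Ore localization (S∩B)⁻¹A (note A embeds in (S∩B)⁻¹A since A is S∩B-torsion free). -/
/-- `j : A →+* Q` realizes `Q` as the left Ore localization `S⁻¹A`:
elements of `S` become invertible, every element of `Q` is a left fraction
`(j s)⁻¹ * (j a)`, and the kernel of `j` is the `S`-torsion of `A`. -/
structure IsLeftOreLocalization {A Q : Type*} [Ring A] [Ring Q]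
    (S : Set A) (j : A →+* Q) : Prop where
  unit : ∀ s ∈ S, IsUnit (j s)
  frac : ∀ q : Q, ∃ s ∈ S, ∃ a : A, j s * q = j a
  ker : ∀ a : A, j a = 0 ↔ ∃ s ∈ S, s * a = 0

namespace RingFiltration

variable {A : Type*} [Ring A] (FA : RingFiltration A)

theorem exists_mem_notMem_sub_one {a : A} {m : ℤ} (ha : a ∉ FA.F m) :
    ∃ p : ℤ, m < p ∧ a ∈ FA.F p ∧ a ∉ FA.F (p - 1) := by
  obtain ⟨N, hN⟩ := FA.exhaustive a
  have hlt : ∀ z : ℤ, a ∈ FA.F z → m + 1 ≤ z := fun z hz => by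
    by_contra! h
    exact ha (FA.mono (by omega) hz)
  obtain ⟨p, hp, hmin⟩ := Int.exists_least_of_bdd (P := fun z => a ∈ FA.F z) ⟨m + 1, hlt⟩ ⟨N, hN⟩
  refine ⟨p, hlt p hp, hp, fun h => ?_⟩
  have := hmin _ h
  omega

theorem exists_notMem_s3 {a : A} (ha : a ≠ 0) : ∃ n : ℤ, a ∉ FA.F n := by
  by_contra! h
  exact ha (FA.separated a h)

variable {FA} {S : Set A}

theorem SigmaTorsionFree.mul_notMem (htf : FA.SigmaTorsionFree S) {s t : A} (hs : s ∈ S)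
    {m n : ℤ} (hsm : s ∉ FA.F m) (htn : t ∉ FA.F n) : s * t ∉ FA.F (m + n + 1) := by
  obtain ⟨N, hN, htN, htN'⟩ := FA.exists_mem_notMem_sub_one htn
  intro hst
  refine htN' (htf s hs N t htN fun q hq => FA.mono ?_ hst)
  have hmq : m < q := by
    by_contra! h
    exact hsm (FA.mono h hq)
  omega

theorem SigmaTorsionFree.ne_zero (htf : FA.SigmaTorsionFree S) [Nontrivial A] {s : A}
    (hs : s ∈ S) : s ≠ 0 := by
  rintro rfl
  obtain ⟨n, hn⟩ := FA.exists_notMem_s3 (one_ne_zero (α := A))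
  obtain ⟨p, -, hp, hp'⟩ := FA.exists_mem_notMem_sub_one hn
  exact hp' (htf 0 hs p 1 hp fun q _ => by simp)

/-- Left multiples by powers of an element of `S` of positive degree have unbounded degree. -/
theorem SigmaTorsionFree.exists_mul_mem_diff (htf : FA.SigmaTorsionFree S) (hone : 1 ∈ S)
    (hmul : MulClosed S) (hS : ¬ S ⊆ (FA.F 0 : Set A)) {w : A} (hw : w ∈ S) :
    ∃ r ∈ S, r * w ∈ S \ (FA.F 0 : Set A) := by
  obtain ⟨t, htS, ht⟩ := Set.not_subset.1 hS
  have : Nontrivial A := ⟨t, 0, fun h => ht (h ▸ (FA.F 0).zero_mem)⟩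
  obtain ⟨n, hn⟩ := FA.exists_notMem_s3 (htf.ne_zero hw)
  have key : ∀ k : ℕ, t ^ k ∈ S ∧ t ^ k * w ∉ FA.F (n + k) := by
    intro k
    induction k with
    | zero => simpa using ⟨hone, hn⟩
    | succ k ih =>
      rw [pow_succ', mul_assoc]
      refine ⟨hmul _ htS _ ih.1, ?_⟩
      have := htf.mul_notMem htS ht ih.2
      rwa [show (0 : ℤ) + (n + k) + 1 = n + (k + 1 : ℕ) by push_cast; ring] at this
  obtain ⟨hkS, hk⟩ := key n.natAbs
  exact ⟨_, hkS, hmul _ hkS _ hw, fun h => hk (FA.mono (by omega) h)⟩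

end RingFiltration

/-- Under the standing hypotheses, `S \ B` is a left Ore set in the
Ore localization `(S ∩ B)⁻¹A` (realized by `j : A →+* Q`, which is injective since
`A` is `S ∩ B`-torsion free). -/
theorem stmt3 {A Q : Type*} [Ring A] [Ring Q] (FA : RingFiltration A) (S : Set A)
    (hS : IsLeftOreSet S)
    (hSBore : IsLeftOreSet (S ∩ (FA.F 0 : Set A)))
    (hOre : FA.SigmaLeftOre S) (htf : FA.SigmaTorsionFree S)
    (hnotsub : ¬ S ⊆ (FA.F 0 : Set A))
    (j : A →+* Q) (hloc : IsLeftOreLocalization (S ∩ (FA.F 0 : Set A)) j) :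
    MulClosed (⇑j '' (S \ (FA.F 0 : Set A))) ∧
    LeftOreCond (⇑j '' (S \ (FA.F 0 : Set A))) ∧
    LeftOreCancel (⇑j '' (S \ (FA.F 0 : Set A))) := by
  obtain ⟨hone, hmul, hore, hcan⟩ := hS
  refine ⟨?_, ?_, ?_⟩
  · rintro _ ⟨s, ⟨hs, hs0⟩, rfl⟩ _ ⟨t, ⟨ht, ht0⟩, rfl⟩
    refine ⟨s * t, ⟨hmul _ hs _ ht, fun h => htf.mul_notMem hs hs0 ht0 ?_⟩, map_mul j s t⟩
    exact FA.mono (by norm_num) h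
  · rintro q _ ⟨s, ⟨hs, -⟩, rfl⟩
    obtain ⟨u, ⟨hu, -⟩, a, hq⟩ := hloc.frac q
    obtain ⟨w, hw, b, hwb⟩ := hore a s hs
    obtain ⟨r, -, hr⟩ := htf.exists_mul_mem_diff hone hmul hnotsub (hmul _ hw _ hu)
    refine ⟨_, ⟨_, hr, rfl⟩, j (r * b), ?_⟩
    rw [← map_mul, mul_assoc r b s, ← hwb]
    simp only [map_mul, mul_assoc, hq]
  · rintro q _ ⟨s, ⟨hs, -⟩, rfl⟩ hqs
    obtain ⟨u, ⟨hu, -⟩, a, hq⟩ := hloc.frac q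
    have has : j (a * s) = 0 := by rw [map_mul, ← hq, mul_assoc, hqs, mul_zero]
    obtain ⟨v, ⟨hv, -⟩, hvas⟩ := (hloc.ker _).1 has
    obtain ⟨w, hw, hwva⟩ := hcan (v * a) s hs (by rw [mul_assoc, hvas])
    obtain ⟨r, -, hr⟩ :=
      htf.exists_mul_mem_diff hone hmul hnotsub (hmul _ (hmul _ hw _ hv) _ hu)
    refine ⟨_, ⟨_, hr, rfl⟩, ?_⟩
    rw [← mul_assoc, map_mul, mul_assoc, hq, ← map_mul, mul_assoc, mul_assoc, hwva, mul_zero,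
      map_zero]
end

section
/- Let fA be a strong ℤ-filtration on a ring A and let FA be its positive part (F_nA = f_nA for n ≥ 0). Let M ⊆ Ω be a standard glider fragment for FA inside an A-module Ω, and let N ⊆ M be a strict glider subfragment, i.e. a glider fragment with chain N_m = M_m ∩ N for all m. Then N is standard: F₁A·N_m = N_{m-1} for all m ≥ 1. -/
/-- A strong filtration: `F m · F n = F (m+n)` for all `m, n ∈ ℤ`. -/
def RingFiltration.IsStrong {A : Type*} [Ring A] (FA : RingFiltration A) : Prop :=
  ∀ m n : ℤ, ∀ x ∈ FA.F (m + n),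
    x ∈ AddSubgroup.closure {y : A | ∃ a ∈ FA.F m, ∃ b ∈ FA.F n, y = a * b}
/-- A glider fragment `M = M 0 ⊇ M 1 ⊇ ⋯` inside an `A`-module `Ω`, for (the
positive part of) the filtration `FA`:  `F i • M j ⊆ M (j - i)` for `i ≤ j`. -/
structure Glider {A : Type*} [Ring A] (FA : RingFiltration A)
    (Ω : Type*) [AddCommGroup Ω] [Module A Ω] where
  M : ℕ → AddSubgroup Ω
  desc : ∀ n : ℕ, M (n + 1) ≤ M n
  smul_mem : ∀ i j : ℕ, i ≤ j → ∀ a : A, a ∈ FA.F (i : ℤ) →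
    ∀ m ∈ M j, a • m ∈ M (j - i)

/-- A glider fragment is standard when `F 1 • M (n+1) = M n` for all `n`. -/
def Glider.Standard {A : Type*} [Ring A] {FA : RingFiltration A}
    {Ω : Type*} [AddCommGroup Ω] [Module A Ω] (G : Glider FA Ω) : Prop :=
  ∀ n : ℕ, (G.M n : Set Ω) =
    (AddSubgroup.closure {x : Ω | ∃ a ∈ FA.F (1 : ℤ), ∃ m ∈ G.M (n + 1), x = a • m} :
      AddSubgroup Ω)

/-- In a standard glider fragment, elements of `F (-1)` map `M n` into `M (n + 1)`. -/
theorem Glider.Standard.smul_mem_succ {A : Type*} [Ring A] {FA : RingFiltration A}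
    {Ω : Type*} [AddCommGroup Ω] [Module A Ω] {G : Glider FA Ω} (hG : G.Standard)
    {b : A} (hb : b ∈ FA.F (-1)) {n : ℕ} {x : Ω} (hx : x ∈ G.M n) :
    b • x ∈ G.M (n + 1) := by
  rw [← SetLike.mem_coe, hG n, SetLike.mem_coe] at hx
  induction hx using AddSubgroup.closure_induction with
  | mem y hy =>
    obtain ⟨a, ha, m, hm, rfl⟩ := hy
    rw [← mul_smul]
    exact G.smul_mem 0 (n + 1) (Nat.zero_le _) _ (by simpa using FA.mul_mem hb ha) m hm
  | zero => simp
  | add y z _ _ hy hz => rw [smul_add]; exact add_mem hy hz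
  | neg y _ hy => rw [smul_neg]; exact neg_mem hy

/-- Over a strong filtration, a glider fragment is standard as soon as elements of `F (-1)`
map `M n` into `M (n + 1)`. -/
theorem Glider.standard_of_smul_mem_succ {A : Type*} [Ring A] {FA : RingFiltration A}
    (hstr : FA.IsStrong) {Ω : Type*} [AddCommGroup Ω] [Module A Ω] {G : Glider FA Ω}
    (h : ∀ n : ℕ, ∀ b ∈ FA.F (-1), ∀ x ∈ G.M n, b • x ∈ G.M (n + 1)) : G.Standard := by
  intro n
  refine congrArg _ (le_antisymm (fun x hx => ?_) ?_)
  · have key : ∀ c ∈ AddSubgroup.closure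
        {y : A | ∃ a ∈ FA.F 1, ∃ b ∈ FA.F (-1), y = a * b},
        c • x ∈ AddSubgroup.closure
          {x : Ω | ∃ a ∈ FA.F (1 : ℤ), ∃ m ∈ G.M (n + 1), x = a • m} := by
      intro c hc
      induction hc using AddSubgroup.closure_induction with
      | mem y hy =>
        obtain ⟨a, ha, b, hb, rfl⟩ := hy
        exact AddSubgroup.subset_closure ⟨a, ha, b • x, h n b hb x hx, mul_smul a b x⟩
      | zero => simp
      | add y z _ _ hy hz => rw [add_smul]; exact add_mem hy hz
      | neg y _ hy => rw [neg_smul]; exact neg_mem hy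
    simpa using key 1 (hstr 1 (-1) 1 (by simpa using FA.one_mem))
  · rw [AddSubgroup.closure_le]
    rintro _ ⟨a, ha, m, hm, rfl⟩
    simpa using G.smul_mem 1 (n + 1) (Nat.le_add_left 1 n) a (by simpa using ha) m hm

/-- Over the positive part of a strong filtration, a strict glider
subfragment (`N m = M m ∩ N`) of a standard glider fragment is standard. -/
theorem stmt6 {A : Type*} [Ring A] (fA : RingFiltration A) (hstr : fA.IsStrong)
    {Ω : Type*} [AddCommGroup Ω] [Module A Ω]
    (Mg Ng : Glider fA Ω) (hMstd : Mg.Standard)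
    (hstrict : ∀ m : ℕ, (Ng.M m : Set Ω) = (Mg.M m : Set Ω) ∩ (Ng.M 0 : Set Ω)) :
    Ng.Standard := by
  refine Glider.standard_of_smul_mem_succ hstr fun n b hb x hx => ?_
  rw [← SetLike.mem_coe, hstrict] at hx ⊢
  refine ⟨hMstd.smul_mem_succ hb hx.1, ?_⟩
  exact Ng.smul_mem 0 0 le_rfl b (fA.mono (by norm_num) hb) x hx.2
end

section
/- Let fA be a strong ℤ-filtration on a ring A and let FA be its positive part. Let M ⊆ Ω be a natural glider fragment for FA inside an A-module Ω, i.e. M_n = {m ∈ M : F_nA·m ⊆ M} for all n ≥ 0. Then M is standard: F₁A·M_n = M_{n-1} for all n ≥ 1. -/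
/-- Over the positive part of a strong filtration, a natural glider
fragment (`M n = {m ∈ M : F n A • m ⊆ M}`) is standard. -/
theorem stmt7 {A : Type*} [Ring A] (fA : RingFiltration A) (hstr : fA.IsStrong)
    {Ω : Type*} [AddCommGroup Ω] [Module A Ω]
    (Mg : Glider fA Ω)
    (hnat : ∀ n : ℕ, (Mg.M n : Set Ω) =
      {ω : Ω | ω ∈ Mg.M 0 ∧ ∀ a ∈ fA.F (n : ℤ), a • ω ∈ Mg.M 0}) :
    Mg.Standard := by
  intro n
  apply Set.Subset.antisymm
  · intro ω hω
    have hω' : ω ∈ Mg.M 0 ∧ ∀ a ∈ fA.F (n : ℤ), a • ω ∈ Mg.M 0 := by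
      rwa [hnat n] at hω
    have hone := hstr 1 (-1) 1 (by simpa using fA.one_mem)
    have key : ∀ x ∈ AddSubgroup.closure
        {y : A | ∃ a ∈ fA.F 1, ∃ b ∈ fA.F (-1), y = a * b},
        x • ω ∈ AddSubgroup.closure
          {x : Ω | ∃ a ∈ fA.F (1 : ℤ), ∃ m ∈ Mg.M (n + 1), x = a • m} := by
      intro x hx
      induction hx using AddSubgroup.closure_induction with
      | mem x hx =>
        obtain ⟨a, ha, b, hb, rfl⟩ := hx
        refine AddSubgroup.subset_closure ⟨a, ha, b • ω, ?_, mul_smul a b ω⟩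
        rw [← SetLike.mem_coe, hnat (n + 1)]
        refine ⟨hω'.2 b (fA.mono (by omega) hb), fun c hc => ?_⟩
        rw [← mul_smul]
        refine hω'.2 _ ?_
        simpa using fA.mul_mem hc hb
      | zero => simp
      | add x y _ _ hx hy => rw [add_smul]; exact add_mem hx hy
      | neg x _ hx => rw [neg_smul]; exact neg_mem hx
    simpa using key 1 hone
  · rw [SetLike.coe_subset_coe, AddSubgroup.closure_le]
    rintro _ ⟨a, ha, m, hm, rfl⟩
    simpa using Mg.smul_mem 1 (n + 1) (by omega) a (by simpa using ha) m hm
end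

section
/- Let R be a filtered ring and κ a Gabriel filter on R such that every I ∈ 𝒲(κ) has a good induced filtration: there exist i₁,…,i_k ∈ I and integers n₁,…,n_k with deg σ(i_j) ≤ n_j and I ∩ F_nR = Σ_j F_{n−n_j}R·i_j for all n (this holds whenever FR is a Zariskian filtration). If M is a filtered R-module such that M/κ(M), with the induced filtration, is κ-separated, then G(κ(M)) = κ̄(G(M)) and G(M/κ(M)) = G(M)/κ̄(G(M)). -/
/-- An exhaustive separated ascending `ℤ`-filtration on an `A`-module `M`,
compatible with the ring filtration `FA`. -/
structure ModuleFiltration {A : Type*} [Ring A] (FA : RingFiltration A)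
    (M : Type*) [AddCommGroup M] [Module A M] where
  F : ℤ → AddSubgroup M
  mono : Monotone F
  smul_mem : ∀ {m n : ℤ} {a : A} {x : M}, a ∈ FA.F m → x ∈ F n → a • x ∈ F (m + n)
  exhaustive : ∀ x : M, ∃ n : ℤ, x ∈ F n
  separated : ∀ x : M, (∀ n : ℤ, x ∈ F n) → x = 0
/-- The left ideal `(I : r) = {a | a * r ∈ I}`. -/
def colonIdeal {R : Type*} [Ring R] (I : Ideal R) (r : R) : Ideal R where
  carrier := {a : R | a * r ∈ I}
  add_mem' := fun {a b} ha hb => by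
    simpa [add_mul] using I.add_mem ha hb
  zero_mem' := by simp
  smul_mem' := fun c a ha => by
    simpa [smul_eq_mul, mul_assoc] using I.smul_mem c ha

/-- A Gabriel filter of left ideals of `R`. -/
structure GabrielFilter (R : Type*) [Ring R] where
  sets : Set (Ideal R)
  top_mem : ⊤ ∈ sets
  upward : ∀ {I J : Ideal R}, I ∈ sets → I ≤ J → J ∈ sets
  inter : ∀ {I J : Ideal R}, I ∈ sets → J ∈ sets → I ⊓ J ∈ sets
  colon : ∀ {I : Ideal R}, I ∈ sets → ∀ r : R, colonIdeal I r ∈ sets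
  gabriel : ∀ {I J : Ideal R}, I ∈ sets → (∀ x ∈ I, colonIdeal J x ∈ sets) → J ∈ sets

/-- The `κ`-torsion elements of a left `R`-module `M`. -/
def GabrielFilter.torsion {R : Type*} [Ring R] (κ : GabrielFilter R)
    (M : Type*) [AddCommGroup M] [Module R M] : Set M :=
  {m : M | ∃ I ∈ κ.sets, ∀ i ∈ I, i • m = 0}

/-- Every `I ∈ 𝒲(κ)` has a good induced filtration (as holds for Zariskian `FR`):
there are `i₁, …, i_k ∈ I` and `n₁, …, n_k ∈ ℤ` with `deg σ(i_j) ≤ n_j` and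
`I ∩ F n R = Σ_j F (n - n_j) R · i_j` for all `n`. -/
def GoodFiltration {R : Type*} [Ring R] (κ : GabrielFilter R)
    (FA : RingFiltration R) : Prop :=
  ∀ I ∈ κ.sets, ∃ (k : ℕ) (g : Fin k → R) (d : Fin k → ℤ),
    (∀ j, g j ∈ I) ∧ (∀ j, g j ∈ FA.F (d j)) ∧
    ∀ (n : ℤ) (x : R), (x ∈ I ∧ x ∈ FA.F n) ↔
      ∃ c : Fin k → R, (∀ j, c j ∈ FA.F (n - d j)) ∧ x = ∑ j, c j * g j

/-- `M/κ(M)`, with the induced filtration `F n (M/κM) = (F n M + κM)/κM`, is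
`κ`-separated. -/
def QuotKappaSeparated {R : Type*} [Ring R] (κ : GabrielFilter R)
    (FA : RingFiltration R) {M : Type*} [AddCommGroup M] [Module R M]
    (FM : ModuleFiltration FA M) : Prop :=
  ∀ (n : ℤ) (x : M),
    (∃ t ∈ κ.torsion M, x - t ∈ FM.F n) →
    (¬ ∃ t ∈ κ.torsion M, x - t ∈ FM.F (n - 1)) →
    (∃ I ∈ κ.sets, ∀ γ : ℤ, ∀ i ∈ I, i ∈ FA.F γ →
      ∃ t ∈ κ.torsion M, i • x - t ∈ FM.F (γ + n - 1)) →
    ∃ I ∈ κ.sets, ∀ i ∈ I, i • x ∈ κ.torsion M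

/-- An element whose multiples by some `I ∈ 𝒲(κ)` are all torsion is itself torsion,
i.e. `M/κ(M)` is torsion-free. -/
theorem GabrielFilter.mem_torsion_of_smul_mem {R : Type*} [Ring R] (κ : GabrielFilter R)
    {M : Type*} [AddCommGroup M] [Module R M] {I : Ideal R} (hI : I ∈ κ.sets) {x : M}
    (h : ∀ i ∈ I, i • x ∈ κ.torsion M) : x ∈ κ.torsion M := by
  refine ⟨LinearMap.ker (LinearMap.toSpanSingleton R M x), κ.gabriel hI fun i hi => ?_,
    fun i hi => by simpa using hi⟩
  obtain ⟨J, hJ, hJx⟩ := h i hi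
  refine κ.upward hJ fun j hj => ?_
  change j * i ∈ LinearMap.ker (LinearMap.toSpanSingleton R M x)
  simpa [mul_smul] using hJx j hj

/-- The zero element is torsion. -/
theorem GabrielFilter.zero_mem_torsion {R : Type*} [Ring R] (κ : GabrielFilter R)
    (M : Type*) [AddCommGroup M] [Module R M] : (0 : M) ∈ κ.torsion M :=
  ⟨⊤, κ.top_mem, fun i _ => smul_zero i⟩

/-- If every `I ∈ 𝒲(κ)` has a good induced filtration and `M/κ(M)`
is `κ`-separated, then `G(κ(M)) = κ̄(G(M))` and `G(M/κ(M)) = G(M)/κ̄(G(M))`.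
Homogeneous formulation: for `x ∈ F n M`, the symbol `σ(x) ∈ G(M)_n` is
`κ̄`-torsion if and only if it lies in `G(κ(M))_n`, i.e. `x ∈ κ(M) + F (n-1) M`
(this simultaneously expresses both asserted equalities). -/
theorem stmt12 {R : Type*} [Ring R] (FA : RingFiltration R) (κ : GabrielFilter R)
    (hgood : GoodFiltration κ FA)
    {M : Type*} [AddCommGroup M] [Module R M] (FM : ModuleFiltration FA M)
    (hsep : QuotKappaSeparated κ FA FM) :
    ∀ (n : ℤ) (x : M), x ∈ FM.F n →
      ((∃ I ∈ κ.sets, ∀ γ : ℤ, ∀ i ∈ I, i ∈ FA.F γ → i • x ∈ FM.F (γ + n - 1)) ↔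
        ∃ t ∈ κ.torsion M, x - t ∈ FM.F (n - 1)) := by
  intro n x hx
  constructor
  · rintro ⟨I, hI, h⟩
    by_contra hne
    obtain ⟨J, hJ, hJx⟩ := hsep n x ⟨0, κ.zero_mem_torsion M, by simpa using hx⟩ hne
      ⟨I, hI, fun γ i hi hγ => ⟨0, κ.zero_mem_torsion M, by simpa using h γ i hi hγ⟩⟩
    exact hne ⟨x, κ.mem_torsion_of_smul_mem hJ hJx, by simp⟩
  · rintro ⟨t, ⟨I, hI, hIt⟩, ht⟩
    refine ⟨I, hI, fun γ i hi hγ => ?_⟩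
    have := FM.smul_mem hγ ht
    rwa [smul_sub, hIt i hi, sub_zero, ← add_sub_assoc] at this
end

section
/- Let R be a filtered ring whose associated graded ring G(R) is a commutative domain. Then R (as a filtered module over itself) is κ-separated for every Gabriel filter κ on R. -/
/-- `G(R)` is commutative (homogeneous formulation). -/
def GradedComm {R : Type*} [Ring R] (FA : RingFiltration R) : Prop :=
  ∀ (m n : ℤ), ∀ a ∈ FA.F m, ∀ b ∈ FA.F n, a * b - b * a ∈ FA.F (m + n - 1)

/-- `G(R)` is a domain (homogeneous formulation). -/
def GradedDomain {R : Type*} [Ring R] (FA : RingFiltration R) : Prop :=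
  ∀ (m n : ℤ), ∀ a ∈ FA.F m, ∀ b ∈ FA.F n,
    a * b ∈ FA.F (m + n - 1) → a ∈ FA.F (m - 1) ∨ b ∈ FA.F (n - 1)

/-- If `G(R)` is a commutative domain then `R` (as a filtered left
module over itself) is `κ`-separated for every Gabriel filter `κ` on `R`. -/
theorem stmt14 {R : Type*} [Ring R] (FA : RingFiltration R)
    (hcomm : GradedComm FA) (hdom : GradedDomain FA) :
    ∀ κ : GabrielFilter R, ∀ (n : ℤ) (r : R), r ∈ FA.F n → r ∉ FA.F (n - 1) →
      (∃ I ∈ κ.sets, ∀ γ : ℤ, ∀ i ∈ I, i ∈ FA.F γ → i * r ∈ FA.F (γ + n - 1)) →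
      ∃ I ∈ κ.sets, ∀ i ∈ I, i * r = 0 := by
  intro κ n r hr hr' ⟨I, hI, h⟩
  refine ⟨I, hI, fun i hi => ?_⟩
  have step : ∀ γ : ℤ, i ∈ FA.F γ → i ∈ FA.F (γ - 1) := fun γ hγ =>
    (hdom γ n i hγ r hr (h γ i hi hγ)).resolve_right hr'
  obtain ⟨m, hm⟩ := FA.exhaustive i
  have down : ∀ k : ℕ, i ∈ FA.F (m - k) := by
    intro k
    induction k with
    | zero => simpa using hm
    | succ k ih =>
      have := step _ ih
      rwa [show m - ((k + 1 : ℕ) : ℤ) = m - k - 1 by push_cast; ring]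
  have hzero : i = 0 := FA.separated i fun l =>
    FA.mono (by have := Int.self_le_toNat (m - l); omega) (down (m - l).toNat)
  rw [hzero, zero_mul]
end

section
/- Let R be a filtered ring and κ a Gabriel filter on R such that every I ∈ 𝒲(κ) has a good induced filtration (as holds when FR is Zariskian). Let M be a filtered R-module such that M/κ(M) is κ-separated, and let Q = Q_κ(M) be the module of quotients: an R-module containing M/κ(M) such that Q is κ-torsion free and for every q ∈ Q there exists I ∈ 𝒲(κ) with Iq ⊆ M/κ(M). Then F_γQ := {q ∈ Q : there exists I ∈ 𝒲(κ) with (I ∩ F_nR)·q ⊆ F_{n+γ}(M/κ(M)) for all n ∈ ℤ} defines an exhaustive ascending filtration on Q for which the localization morphism j_κ : M → Q is a strict filtered morphism, i.e. F_γQ ∩ (M/κ(M)) = F_γ(M/κ(M)) for all γ. The analogous filtration on the ring of quotients Q_κ(R) (when R/κ(R) is κ-separated) makes Q_κ(R) a filtered ring with j_κ : R → Q_κ(R) a strict filtered ring morphism, and Q_κ(M) is then a filtered Q_κ(R)-module. Moreover, if M itself is κ-separated then the filtration FQ_κ(M) is separated. -/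
/-- `M` is `κ`-separated: if `m ∈ F n M \ F (n-1) M` and some `I ∈ 𝒲(κ)` satisfies
`(I ∩ F γ R) • m ⊆ F (γ+n-1) M` for all `γ` (i.e. `G(I) · σ(m) = 0` in `G(M)`),
then `m ∈ κ(M)`. -/
def KappaSeparated {R : Type*} [Ring R] (κ : GabrielFilter R)
    (FA : RingFiltration R) {M : Type*} [AddCommGroup M] [Module R M]
    (FM : ModuleFiltration FA M) : Prop :=
  ∀ (n : ℤ) (x : M), x ∈ FM.F n → x ∉ FM.F (n - 1) →
    (∃ I ∈ κ.sets, ∀ γ : ℤ, ∀ i ∈ I, i ∈ FA.F γ → i • x ∈ FM.F (γ + n - 1)) →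
    x ∈ κ.torsion M

/-- `R`, filtered by `FA`, viewed as a filtered module over itself. -/
def RingFiltration.toModuleFiltration {R : Type*} [Ring R] (FA : RingFiltration R) :
    ModuleFiltration FA R where
  F := FA.F
  mono := FA.mono
  smul_mem := fun ha hx => by simpa [smul_eq_mul] using FA.mul_mem ha hx
  exhaustive := FA.exhaustive
  separated := FA.separated

/-- The localization filtration on `Q`, with respect to `j : M → Q`: `q` has degree at most `γ`
if some `I ∈ 𝒲(κ)` satisfies `(I ∩ F n R) • q ⊆ j (F (n + γ) M)` for all `n`. -/
def GabrielFilter.quotientFiltration {R M Q : Type*} [Ring R] [AddCommGroup M] [Module R M]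
    [AddCommGroup Q] [Module R Q] (κ : GabrielFilter R) {FA : RingFiltration R}
    (FM : ModuleFiltration FA M) (j : M →ₗ[R] Q) (γ : ℤ) : AddSubgroup Q where
  carrier := {q | ∃ I ∈ κ.sets, ∀ n : ℤ, ∀ i ∈ I, i ∈ FA.F n →
    i • q ∈ (FM.F (n + γ)).map j.toAddMonoidHom}
  zero_mem' := ⟨⊤, κ.top_mem, fun n i _ _ => by simp [zero_mem]⟩
  add_mem' := by
    rintro x y ⟨I, hI, hx⟩ ⟨J, hJ, hy⟩
    refine ⟨I ⊓ J, κ.inter hI hJ, fun n i hi hin => ?_⟩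
    rw [smul_add]
    exact add_mem (hx n i hi.1 hin) (hy n i hi.2 hin)
  neg_mem' := by
    rintro x ⟨I, hI, hx⟩
    refine ⟨I, hI, fun n i hi hin => ?_⟩
    rw [smul_neg]
    exact neg_mem (hx n i hi hin)

namespace GabrielFilter

section quotientFiltration

variable {R M Q : Type*} [Ring R] [AddCommGroup M] [Module R M] [AddCommGroup Q] [Module R Q]
  {κ : GabrielFilter R} {FA : RingFiltration R} {FM : ModuleFiltration FA M} {j : M →ₗ[R] Q}

theorem mem_quotientFiltration {γ : ℤ} {q : Q} :
    q ∈ κ.quotientFiltration FM j γ ↔ ∃ I ∈ κ.sets, ∀ n : ℤ, ∀ i ∈ I, i ∈ FA.F n →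
      i • q ∈ (FM.F (n + γ)).map j.toAddMonoidHom :=
  Iff.rfl

theorem mem_quotientFiltration_iff_exists {γ : ℤ} {q : Q} :
    q ∈ κ.quotientFiltration FM j γ ↔ ∃ I ∈ κ.sets, ∀ n : ℤ, ∀ i ∈ I, i ∈ FA.F n →
      ∃ m ∈ FM.F (n + γ), i • q = j m := by
  simp [mem_quotientFiltration, eq_comm]

theorem map_mem_map_iff (hker : ∀ m : M, j m = 0 ↔ m ∈ κ.torsion M) {n : ℤ} {x : M} :
    j x ∈ (FM.F n).map j.toAddMonoidHom ↔ ∃ t ∈ κ.torsion M, x - t ∈ FM.F n := by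
  constructor
  · rintro ⟨m, hm, h⟩
    refine ⟨x - m, (hker _).1 ?_, by simpa using hm⟩
    rw [map_sub, sub_eq_zero]
    exact h.symm
  · rintro ⟨t, ht, h⟩
    refine ⟨x - t, h, ?_⟩
    simp [(hker t).2 ht]

theorem map_filtration_mono {m n : ℤ} (h : m ≤ n) :
    (FM.F m).map j.toAddMonoidHom ≤ (FM.F n).map j.toAddMonoidHom :=
  AddSubgroup.map_mono (FM.mono h)

theorem smul_mem_map_filtration {m n : ℤ} {a : R} {q : Q} (ha : a ∈ FA.F m)
    (hq : q ∈ (FM.F n).map j.toAddMonoidHom) :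
    a • q ∈ (FM.F (m + n)).map j.toAddMonoidHom := by
  obtain ⟨x, hx, rfl⟩ := hq
  exact ⟨a • x, FM.smul_mem ha hx, map_smul j a x⟩

theorem quotientFiltration_mono : Monotone (κ.quotientFiltration FM j) := by
  rintro γ δ h q ⟨I, hI, hq⟩
  exact ⟨I, hI, fun n i hi hin => map_filtration_mono (by lia) (hq n i hi hin)⟩

theorem map_mem_quotientFiltration_of_mem {γ : ℤ} {m : M} (hm : m ∈ FM.F γ) :
    j m ∈ κ.quotientFiltration FM j γ :=
  ⟨⊤, κ.top_mem, fun _ _ _ hin => smul_mem_map_filtration hin ⟨m, hm, rfl⟩⟩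

theorem smul_mem_quotientFiltration {n γ : ℤ} {r : R} {q : Q} (hr : r ∈ FA.F n)
    (hq : q ∈ κ.quotientFiltration FM j γ) :
    r • q ∈ κ.quotientFiltration FM j (n + γ) := by
  obtain ⟨I, hI, hq⟩ := hq
  refine ⟨colonIdeal I r, κ.colon hI r, fun m a ha ham => ?_⟩
  rw [smul_smul, ← add_assoc]
  exact hq (m + n) (a * r) ha (FA.mul_mem ham hr)

theorem exists_mem_quotientFiltration (hgood : GoodFiltration κ FA) {q : Q}
    (hsat : ∃ I ∈ κ.sets, ∀ i ∈ I, ∃ m : M, i • q = j m) :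
    ∃ γ : ℤ, q ∈ κ.quotientFiltration FM j γ := by
  obtain ⟨I, hI, hq⟩ := hsat
  obtain ⟨k, g, d, hgI, -, hg⟩ := hgood I hI
  have hdeg : ∀ l, ∃ e : ℤ, g l • q ∈ (FM.F e).map j.toAddMonoidHom := fun l => by
    obtain ⟨m, hm⟩ := hq (g l) (hgI l)
    obtain ⟨e, he⟩ := FM.exhaustive m
    exact ⟨e, m, he, hm.symm⟩
  choose e he using hdeg
  obtain ⟨γ, hγ⟩ := (Set.finite_range fun l => e l - d l).bddAbove
  refine ⟨γ, I, hI, fun n i hi hin => ?_⟩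
  obtain ⟨c, hc, rfl⟩ := (hg n i).1 ⟨hi, hin⟩
  rw [Finset.sum_smul]
  refine sum_mem fun l _ => ?_
  have hl : e l - d l ≤ γ := hγ ⟨l, rfl⟩
  rw [mul_smul]
  exact map_filtration_mono (by lia) (smul_mem_map_filtration (hc l) (he l))

theorem map_mem_quotientFiltration_iff (hsep : QuotKappaSeparated κ FA FM)
    (hker : ∀ m : M, j m = 0 ↔ m ∈ κ.torsion M)
    (htf : ∀ q : Q, (∃ I ∈ κ.sets, ∀ i ∈ I, i • q = 0) → q = 0) {γ : ℤ} {m : M} :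
    j m ∈ κ.quotientFiltration FM j γ ↔ j m ∈ (FM.F γ).map j.toAddMonoidHom := by
  constructor
  · rintro ⟨I, hI, hm⟩
    by_contra hγ
    obtain ⟨p, hp⟩ := FM.exhaustive m
    obtain ⟨n, hn, hmin⟩ := Int.exists_least_of_bdd
      (P := fun n => j m ∈ (FM.F n).map j.toAddMonoidHom)
      ⟨γ, fun z hz => by
        by_contra! h
        exact hγ (map_filtration_mono h.le hz)⟩
      ⟨p, m, hp, rfl⟩
    have hlt : γ < n := by
      by_contra! h
      exact hγ (map_filtration_mono h hn)
    obtain ⟨J, hJ, hJm⟩ := hsep n m ((map_mem_map_iff hker).1 hn)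
      (fun h => by
        have := hmin (n - 1) ((map_mem_map_iff hker).2 h)
        lia)
      ⟨I, hI, fun δ i hi hiδ => (map_mem_map_iff hker).1 <| by
        rw [map_smul]
        exact map_filtration_mono (by lia) (hm δ i hi hiδ)⟩
    refine hγ ?_
    rw [htf (j m) ⟨J, hJ, fun i hi => by rw [← map_smul]; exact (hker _).2 (hJm i hi)⟩]
    exact zero_mem _
  · rintro ⟨x, hx, h⟩
    rw [← h]
    exact map_mem_quotientFiltration_of_mem hx

theorem mem_torsion_of_forall_map_mem_map (hsep : KappaSeparated κ FA FM)
    (hker : ∀ m : M, j m = 0 ↔ m ∈ κ.torsion M) {m : M}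
    (hm : ∀ n : ℤ, j m ∈ (FM.F n).map j.toAddMonoidHom) : m ∈ κ.torsion M := by
  by_cases h0 : ∀ n : ℤ, m ∈ FM.F n
  · rw [← hker, FM.separated m h0, map_zero]
  · push Not at h0
    obtain ⟨b, hb⟩ := h0
    obtain ⟨n, hn, hmin⟩ := Int.exists_least_of_bdd (P := fun n => m ∈ FM.F n)
      ⟨b, fun z hz => by
        by_contra! h
        exact hb (FM.mono h.le hz)⟩
      (FM.exhaustive m)
    obtain ⟨t, ⟨I, hI, hIt⟩, ht⟩ := (map_mem_map_iff hker).1 (hm (n - 1))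
    refine hsep n m hn (fun h => ?_) ⟨I, hI, fun γ i hi hiγ => ?_⟩
    · have := hmin _ h
      lia
    · have := FM.smul_mem hiγ ht
      rwa [smul_sub, hIt i hi, sub_zero, ← add_sub_assoc] at this

theorem eq_zero_of_forall_mem_quotientFiltration (hsep' : QuotKappaSeparated κ FA FM)
    (hsep : KappaSeparated κ FA FM)
    (hker : ∀ m : M, j m = 0 ↔ m ∈ κ.torsion M)
    (htf : ∀ q : Q, (∃ I ∈ κ.sets, ∀ i ∈ I, i • q = 0) → q = 0) {q : Q}
    (hsat : ∃ I ∈ κ.sets, ∀ i ∈ I, ∃ m : M, i • q = j m)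
    (hq : ∀ γ : ℤ, q ∈ κ.quotientFiltration FM j γ) : q = 0 := by
  obtain ⟨I, hI, hIq⟩ := hsat
  refine htf q ⟨I, hI, fun i hi => ?_⟩
  obtain ⟨m, hm⟩ := hIq i hi
  obtain ⟨d, hd⟩ := FA.exhaustive i
  rw [hm, hker]
  refine mem_torsion_of_forall_map_mem_map hsep hker fun n => ?_
  rw [← map_mem_quotientFiltration_iff hsep' hker htf, ← hm, ← add_sub_cancel d n]
  exact smul_mem_quotientFiltration hd (hq _)

theorem smul_mem_quotientFiltration_of_mem {S : Type*} [Ring S] [Module S Q] [Module R S]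
    [IsScalarTower R S Q] {jS : R →ₗ[R] S} (hS : ∀ (r : R) (q : Q), jS r • q = r • q)
    (hsep : QuotKappaSeparated κ FA FM)
    (hker : ∀ m : M, j m = 0 ↔ m ∈ κ.torsion M)
    (htf : ∀ q : Q, (∃ I ∈ κ.sets, ∀ i ∈ I, i • q = 0) → q = 0)
    (hsat : ∀ q : Q, ∃ I ∈ κ.sets, ∀ i ∈ I, ∃ m : M, i • q = j m)
    {γ δ : ℤ} {s : S} {q : Q}
    (hs : s ∈ κ.quotientFiltration FA.toModuleFiltration jS γ)
    (hq : q ∈ κ.quotientFiltration FM j δ) :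
    s • q ∈ κ.quotientFiltration FM j (γ + δ) := by
  obtain ⟨I, hI, hs⟩ := hs
  obtain ⟨J, hJ, hJq⟩ := hsat (s • q)
  refine ⟨I ⊓ J, κ.inter hI hJ, fun n i hi hin => ?_⟩
  obtain ⟨r, hr, hrs⟩ := hs n i hi.1 hin
  obtain ⟨m, hm⟩ := hJq i hi.2
  rw [hm, ← map_mem_quotientFiltration_iff hsep hker htf, ← hm, ← smul_assoc, ← hrs]
  rw [← add_assoc]
  change jS r • q ∈ _
  rw [hS]
  exact smul_mem_quotientFiltration hr hq

end quotientFiltration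

end GabrielFilter

/-- The quotient filtration on the module of quotients `Q_κ(M)`
(and on the ring of quotients `Q_κ(R)`): it is an exhaustive filtration making the
localization morphisms strict filtered (ring) morphisms, `Q_κ(M)` is a filtered
`Q_κ(R)`-module, and the filtration is separated whenever `M` is `κ`-separated. -/
theorem stmt15 {R M Q QR : Type*} [Ring R] [AddCommGroup M] [Module R M]
    [AddCommGroup Q] [Module R Q] [Ring QR] [Module QR Q]
    (FA : RingFiltration R) (κ : GabrielFilter R)
    (hgood : GoodFiltration κ FA)
    (FM : ModuleFiltration FA M)
    (hMsep : QuotKappaSeparated κ FA FM)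
    (hRsep : QuotKappaSeparated κ FA FA.toModuleFiltration)
    -- `Q = Q_κ(M)`, the module of quotients of `M` at `κ`
    (j : M →ₗ[R] Q)
    (hker : ∀ m : M, j m = 0 ↔ m ∈ κ.torsion M)
    (htf : ∀ q : Q, (∃ I ∈ κ.sets, ∀ i ∈ I, i • q = 0) → q = 0)
    (hsat : ∀ q : Q, ∃ I ∈ κ.sets, ∀ i ∈ I, ∃ m : M, i • q = j m)
    -- `QR = Q_κ(R)`, the ring of quotients of `R` at `κ`
    (jR : R →+* QR)
    (hkerR : ∀ r : R, jR r = 0 ↔ r ∈ κ.torsion R)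
    (htfR : ∀ x : QR, (∃ I ∈ κ.sets, ∀ i ∈ I, jR i * x = 0) → x = 0)
    (hsatR : ∀ x : QR, ∃ I ∈ κ.sets, ∀ i ∈ I, ∃ r : R, jR i * x = jR r)
    (hcomp : ∀ (r : R) (q : Q), jR r • q = r • q)
    -- the quotient filtrations on `Q_κ(M)` and `Q_κ(R)`
    (FQ : ℤ → Set Q)
    (hFQ : ∀ (γ : ℤ) (q : Q), q ∈ FQ γ ↔
      ∃ I ∈ κ.sets, ∀ n : ℤ, ∀ i ∈ I, i ∈ FA.F n →
        ∃ m ∈ FM.F (n + γ), i • q = j m)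
    (FQR : ℤ → Set QR)
    (hFQR : ∀ (γ : ℤ) (x : QR), x ∈ FQR γ ↔
      ∃ I ∈ κ.sets, ∀ n : ℤ, ∀ i ∈ I, i ∈ FA.F n →
        ∃ r ∈ FA.F (n + γ), jR i * x = jR r) :
    -- `FQ` is an exhaustive (ascending) filtration by additive subgroups of `Q`
    ((∀ γ : ℤ, (0 : Q) ∈ FQ γ ∧ (∀ x ∈ FQ γ, ∀ y ∈ FQ γ, x + y ∈ FQ γ) ∧
        (∀ x ∈ FQ γ, -x ∈ FQ γ)) ∧
     (∀ γ δ : ℤ, γ ≤ δ → FQ γ ⊆ FQ δ) ∧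
     (∀ q : Q, ∃ γ : ℤ, q ∈ FQ γ) ∧
     -- the localization morphism `j_κ : M → Q_κ(M)` is strict filtered
     (∀ (γ : ℤ) (m : M), j m ∈ FQ γ ↔ ∃ t ∈ κ.torsion M, m - t ∈ FM.F γ)) ∧
    -- `FQR` makes `Q_κ(R)` a filtered ring with `j_κ : R → Q_κ(R)` strict filtered
    ((∀ γ : ℤ, (0 : QR) ∈ FQR γ ∧ (∀ x ∈ FQR γ, ∀ y ∈ FQR γ, x + y ∈ FQR γ) ∧
        (∀ x ∈ FQR γ, -x ∈ FQR γ)) ∧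
     (∀ γ δ : ℤ, γ ≤ δ → FQR γ ⊆ FQR δ) ∧
     (∀ x : QR, ∃ γ : ℤ, x ∈ FQR γ) ∧
     (1 : QR) ∈ FQR 0 ∧
     (∀ γ δ : ℤ, ∀ x ∈ FQR γ, ∀ y ∈ FQR δ, x * y ∈ FQR (γ + δ)) ∧
     (∀ (γ : ℤ) (r : R), jR r ∈ FQR γ ↔ ∃ t ∈ κ.torsion R, r - t ∈ FA.F γ)) ∧
    -- `Q_κ(M)` is a filtered `Q_κ(R)`-module
    (∀ γ δ : ℤ, ∀ x ∈ FQR γ, ∀ q ∈ FQ δ, x • q ∈ FQ (γ + δ)) ∧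
    -- if `M` itself is `κ`-separated then the quotient filtration is separated
    (KappaSeparated κ FA FM → ∀ q : Q, (∀ γ : ℤ, q ∈ FQ γ) → q = 0) := by
  let : Module R QR := Module.compHom QR jR
  have : IsScalarTower R QR Q := ⟨fun r x q => (mul_smul (jR r) x q).trans (hcomp r (x • q))⟩
  have : IsScalarTower R QR QR := ⟨fun r x y => mul_assoc (jR r) x y⟩
  let jS : R →ₗ[R] QR := { toFun := jR, map_add' := jR.map_add, map_smul' := jR.map_mul }
  have hFQ' : ∀ γ, FQ γ = κ.quotientFiltration FM j γ := fun γ => Set.ext fun q =>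
    (hFQ γ q).trans GabrielFilter.mem_quotientFiltration_iff_exists.symm
  have hFQR' : ∀ γ, FQR γ = κ.quotientFiltration FA.toModuleFiltration jS γ :=
    fun γ => Set.ext fun x =>
      (hFQR γ x).trans (GabrielFilter.mem_quotientFiltration_iff_exists (FM := FA.toModuleFiltration)
        (j := jS)).symm
  simp only [hFQ', hFQR', SetLike.mem_coe, SetLike.coe_subset_coe]
  refine ⟨⟨fun γ => ⟨zero_mem _, fun _ hx _ hy => add_mem hx hy, fun _ hx => neg_mem hx⟩,
      fun _ _ h => GabrielFilter.quotientFiltration_mono h,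
      fun q => GabrielFilter.exists_mem_quotientFiltration hgood (hsat q),
      fun γ m => (GabrielFilter.map_mem_quotientFiltration_iff hMsep hker htf).trans
        (GabrielFilter.map_mem_map_iff hker)⟩,
    ⟨fun γ => ⟨zero_mem _, fun _ hx _ hy => add_mem hx hy, fun _ hx => neg_mem hx⟩,
      fun _ _ h => GabrielFilter.quotientFiltration_mono h,
      fun x => GabrielFilter.exists_mem_quotientFiltration hgood (hsatR x),
      ?_,
      fun γ δ x hx y hy => GabrielFilter.smul_mem_quotientFiltration_of_mem (jS := jS)
        (fun _ _ => rfl) hRsep hkerR htfR hsatR hx hy,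
      fun γ r => (GabrielFilter.map_mem_quotientFiltration_iff (j := jS) hRsep hkerR htfR).trans
        (GabrielFilter.map_mem_map_iff (FM := FA.toModuleFiltration) (j := jS) hkerR)⟩,
    fun γ δ x hx q hq => GabrielFilter.smul_mem_quotientFiltration_of_mem (jS := jS)
      hcomp hMsep hker htf hsat hx hq,
    fun hsep q hq => GabrielFilter.eq_zero_of_forall_mem_quotientFiltration hMsep hsep hker htf
      (hsat q) hq⟩
  rw [← jR.map_one]
  exact GabrielFilter.map_mem_quotientFiltration_of_mem (FM := FA.toModuleFiltration) (j := jS)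
    FA.one_mem
end

section
/- Let R be a filtered ring, κ a Gabriel filter on R, and M a filtered R-module that is κ-separated. Then the torsion submodule κ(M) is closed in M, i.e. ⋂_γ (κ(M) + F_γM) = κ(M), and consequently M/κ(M) with the induced quotient filtration is separated. -/
theorem ModuleFiltration.exists_mem_notMem_sub_one {A : Type*} [Ring A] {FA : RingFiltration A}
    {M : Type*} [AddCommGroup M] [Module A M] (FM : ModuleFiltration FA M) {x : M} (hx : x ≠ 0) :
    ∃ n : ℤ, x ∈ FM.F n ∧ x ∉ FM.F (n - 1) := by
  obtain ⟨m, hm⟩ : ∃ m : ℤ, x ∉ FM.F m := by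
    by_contra! h
    exact hx (FM.separated x h)
  obtain ⟨n, hn, hmin⟩ := Int.exists_least_of_bdd (P := fun z => x ∈ FM.F z)
    ⟨m, fun z hz => by
      by_contra! h
      exact hm (FM.mono h.le hz)⟩ (FM.exhaustive x)
  refine ⟨n, hn, fun h => ?_⟩
  have := hmin _ h
  omega

theorem KappaSeparated.mem_torsion_of_forall_sub_mem {R : Type*} [Ring R] {κ : GabrielFilter R}
    {FA : RingFiltration R} {M : Type*} [AddCommGroup M] [Module R M]
    {FM : ModuleFiltration FA M} (hsep : KappaSeparated κ FA FM) {x : M}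
    (hx : ∀ γ : ℤ, ∃ t ∈ κ.torsion M, x - t ∈ FM.F γ) : x ∈ κ.torsion M := by
  rcases eq_or_ne x 0 with rfl | hx0
  · exact κ.zero_mem_torsion M
  obtain ⟨n, hn, hn'⟩ := FM.exists_mem_notMem_sub_one hx0
  obtain ⟨t, ⟨I, hI, hIt⟩, ht⟩ := hx (n - 1)
  refine hsep n x hn hn' ⟨I, hI, fun γ i hi hiγ => ?_⟩
  have h := FM.smul_mem hiγ ht
  rwa [smul_sub, hIt i hi, sub_zero, ← add_sub_assoc] at h

/-- If `M` is `κ`-separated then `κ(M)` is closed,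
`⋂_γ (κ(M) + F γ M) = κ(M)`, so `M/κ(M)` with the quotient filtration is
separated. -/
theorem stmt16 {R : Type*} [Ring R] (FA : RingFiltration R) (κ : GabrielFilter R)
    {M : Type*} [AddCommGroup M] [Module R M] (FM : ModuleFiltration FA M)
    (hsep : KappaSeparated κ FA FM) :
    (⋂ γ : ℤ, {x : M | ∃ t ∈ κ.torsion M, x - t ∈ FM.F γ}) = κ.torsion M ∧
    -- separatedness of `M/κ(M)`: anything in every layer of the quotient
    -- filtration is zero in `M/κ(M)`
    (∀ x : M, (∀ γ : ℤ, ∃ t ∈ κ.torsion M, x - t ∈ FM.F γ) → x ∈ κ.torsion M) := by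
  refine ⟨Set.Subset.antisymm
    (fun x hx => hsep.mem_torsion_of_forall_sub_mem (Set.mem_iInter.mp hx))
    (fun x hx => Set.mem_iInter.mpr fun γ => ⟨x, hx, ?_⟩),
    fun x hx => hsep.mem_torsion_of_forall_sub_mem hx⟩
  rw [sub_self]
  exact (FM.F γ).zero_mem
end

section
/- Let R be a left Noetherian ring, let τ and κ be Gabriel filters on R, and let M be a left R-module. Define τκ(M) = {m ∈ M : there exist finitely many x₁,…,x_k ∈ R with Σ_j Rx_j ∈ 𝒲(κ) and an ideal J ∈ 𝒲(τ) such that (Σ_j J x_j)·m = 0}. Then m ∈ τκ(M) if and only if the image of m in M/τ(M) lies in κ(M/τ(M)). Consequently κ(M/τ(M)) = τκ(M)/τ(M). -/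
namespace GabrielFilter

variable {R : Type*} [Ring R]

/-- The torsion elements of a module, bundled as a submodule. -/
def torsionSubmodule (τ : GabrielFilter R) (M : Type*) [AddCommGroup M] [Module R M] :
    Submodule R M where
  carrier := τ.torsion M
  add_mem' := by
    rintro m n ⟨I, hI, hm⟩ ⟨J, hJ, hn⟩
    refine ⟨I ⊓ J, τ.inter hI hJ, fun i hi => ?_⟩
    rw [smul_add, hm i hi.1, hn i hi.2, add_zero]
  zero_mem' := ⟨⊤, τ.top_mem, fun _ _ => smul_zero _⟩
  smul_mem' := by
    rintro r m ⟨I, hI, hm⟩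
    refine ⟨colonIdeal I r, τ.colon hI r, fun i hi => ?_⟩
    rw [← mul_smul]
    exact hm _ hi

theorem finset_inf_mem (τ : GabrielFilter R) {ι : Type*} (s : Finset ι) (J : ι → Ideal R)
    (hJ : ∀ i ∈ s, J i ∈ τ.sets) : s.inf J ∈ τ.sets :=
  Finset.inf_induction τ.top_mem (fun _ h₁ _ h₂ => τ.inter h₁ h₂) hJ

end GabrielFilter

/-- For a left Noetherian ring `R`, Gabriel filters `τ, κ` and a
module `M`:  `m ∈ τκ(M)` (i.e. `(Σ_j J x_j) • m = 0` for some `x₁, …, x_k` with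
`Σ_j R x_j ∈ 𝒲(κ)` and some `J ∈ 𝒲(τ)`) if and only if the image of `m` in
`M/τ(M)` lies in `κ(M/τ(M))`; consequently `κ(M/τ(M)) = τκ(M)/τ(M)`. -/
theorem stmt17 {R : Type*} [Ring R] [IsNoetherianRing R]
    (τ κ : GabrielFilter R)
    {M : Type*} [AddCommGroup M] [Module R M] :
    ∀ m : M,
      (∃ (k : ℕ) (x : Fin k → R), Ideal.span (Set.range x) ∈ κ.sets ∧
        ∃ J ∈ τ.sets, ∀ (l : Fin k), ∀ a ∈ J, (a * x l) • m = 0) ↔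
      (∃ I ∈ κ.sets, ∀ i ∈ I, i • m ∈ τ.torsion M) := by
  intro m
  constructor
  · rintro ⟨k, x, hx, J, hJ, h⟩
    refine ⟨_, hx, ?_⟩
    have hle : Ideal.span (Set.range x) ≤
        (τ.torsionSubmodule M).comap (LinearMap.toSpanSingleton R M m) := by
      refine Submodule.span_le.2 ?_
      rintro _ ⟨l, rfl⟩
      exact ⟨J, hJ, fun a ha => by simpa [mul_smul] using h l a ha⟩
    exact fun i hi => hle hi
  · rintro ⟨I, hI, h⟩
    obtain ⟨k, x, rfl⟩ := Submodule.fg_iff_exists_fin_generating_family.1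
      (IsNoetherian.noetherian I)
    choose J hJ hJx using fun l => h (x l) (Submodule.subset_span ⟨l, rfl⟩)
    refine ⟨k, x, hI, Finset.univ.inf J, τ.finset_inf_mem _ J fun l _ => hJ l, fun l a ha => ?_⟩
    rw [mul_smul]
    exact hJx l a (Finset.inf_le (f := J) (Finset.mem_univ l) ha)
end

section
/- Let R be a (possibly noncommutative) domain and let T and S be left Ore sets in R. Let 𝒲(κ_T) = {left ideals J of R : J ∩ T ≠ ∅} and likewise 𝒲(κ_S). Define 𝒲(κ_Tκ_S) as the set of left ideals L of R for which there exist finitely many x₁,…,x_k ∈ R with Σ_j Rx_j ∈ 𝒲(κ_S) and an ideal J ∈ 𝒲(κ_T) such that Σ_j J x_j ⊆ L. Then 𝒲(κ_Tκ_S) = {L : ts ∈ L for some t ∈ T, s ∈ S}, i.e. the composed filter has the principal left ideals Rts (t ∈ T, s ∈ S) as a filter basis. -/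
/-- The Gabriel filter `𝒲(κ_S)` of a left Ore set `S`: the left ideals of `R`
meeting `S`. -/
def oreFilter {R : Type*} [Ring R] (S : Set R) : Set (Ideal R) :=
  {J : Ideal R | ∃ s ∈ S, s ∈ J}

/-- The left ideal of elements carried into `L` by left multiplication by some element of a left
Ore set `T`. -/
def IsLeftOreSet.saturation {R : Type*} [Ring R] {T : Set R} (hT : IsLeftOreSet T)
    (L : Ideal R) : Ideal R where
  carrier := {y | ∃ t ∈ T, t * y ∈ L}
  zero_mem' := ⟨1, hT.1, by simp⟩
  add_mem' := by
    rintro y z ⟨t, ht, hty⟩ ⟨u, hu, huz⟩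
    obtain ⟨v, hv, a, hva⟩ := hT.2.2.1 t u hu
    refine ⟨v * t, hT.2.1 v hv t ht, ?_⟩
    rw [mul_add]
    refine L.add_mem ?_ ?_
    · rw [mul_assoc]
      exact L.mul_mem_left v hty
    · rw [hva, mul_assoc]
      exact L.mul_mem_left a huz
  smul_mem' := by
    rintro c y ⟨t, ht, hty⟩
    obtain ⟨v, hv, a, hva⟩ := hT.2.2.1 c t ht
    refine ⟨v, hv, ?_⟩
    rw [smul_eq_mul, ← mul_assoc, hva, mul_assoc]
    exact L.mul_mem_left a hty


/-- For left Ore sets `T, S` in a domain `R`, the composed filter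
`𝒲(κ_T κ_S)` (left ideals containing some `Σ_j J x_j` with `Σ_j R x_j ∈ 𝒲(κ_S)`
and `J ∈ 𝒲(κ_T)`) has the principal left ideals `R·t·s` (`t ∈ T`, `s ∈ S`) as a
filter basis: it equals `{L : t·s ∈ L for some t ∈ T, s ∈ S}`. -/
theorem stmt19 {R : Type*} [Ring R] [IsDomain R] (T S : Set R)
    (hT : IsLeftOreSet T) (hS : IsLeftOreSet S) :
    {L : Ideal R | ∃ (k : ℕ) (x : Fin k → R),
        Ideal.span (Set.range x) ∈ oreFilter S ∧
        ∃ J ∈ oreFilter T, ∀ (l : Fin k), ∀ a ∈ J, a * x l ∈ L} =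
    {L : Ideal R | ∃ t ∈ T, ∃ s ∈ S, t * s ∈ L} := by
  ext L
  constructor
  · rintro ⟨k, x, ⟨s, hs, hsx⟩, J, ⟨t, ht, htJ⟩, hJ⟩
    have hle : Ideal.span (Set.range x) ≤ hT.saturation L := by
      rw [Ideal.span_le]
      rintro _ ⟨l, rfl⟩
      exact ⟨t, ht, hJ l t htJ⟩
    obtain ⟨u, hu, hus⟩ := hle hsx
    exact ⟨u, hu, s, hs, hus⟩
  · rintro ⟨t, ht, s, hs, hts⟩
    refine ⟨1, fun _ => s, ⟨s, hs, Ideal.subset_span ⟨0, rfl⟩⟩, Ideal.span {t},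
      ⟨t, ht, Ideal.subset_span rfl⟩, fun _ a ha => ?_⟩
    obtain ⟨r, rfl⟩ := Submodule.mem_span_singleton.mp ha
    rw [smul_eq_mul, mul_assoc]
    exact L.mul_mem_left r hts
end
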